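/- arXiv:1409.6008 — 7 statements merged into one kernel-verified Lean document; each statement's English description precedes it below -/
import Mathlib

section
/- Suppose each D_i is a compact subset of ℝ and k : D×D → ℝ is a continuous symmetric positive definite kernel. Then for any family of real numbers (α_u)_{u⊆I}, the function (x,y) ↦ Σ_{u⊆I} Σ_{v⊆I} α_u α_v k_{u,v}(x,y) is again a symmetric positive definite kernel on D×D, where k_{u,v} is the KANOVA term of k. -/
open MeasureTheory Finset

/-- Substitute the coordinates in `u` from `x`, the remaining coordinates from `z`. -/
def combine {d : ℕ} (D : Fin d → Set ℝ) (u : Finset (Fin d)) (x z : ∀ i, D i) : ∀ i, D i :=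
  fun j => if j ∈ u then x j else z j

/-- KANOVA term `k_{u,v}` of a kernel `k`. -/
noncomputable def kanova {d : ℕ} (D : Fin d → Set ℝ) (ν : ∀ i, Measure (D i))
    (u v : Finset (Fin d)) (k : (∀ i, D i) → (∀ i, D i) → ℝ) :
    (∀ i, D i) → (∀ i, D i) → ℝ :=
  fun x y => ∑ u' ∈ u.powerset, ∑ v' ∈ v.powerset,
    (-1 : ℝ) ^ (u.card + v.card - u'.card - v'.card) *
    ∫ z, (∫ w, k (combine D u' x z) (combine D v' y w) ∂(Measure.pi ν)) ∂(Measure.pi ν)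

open ProbabilityTheory in
/-- A continuous kernel on a compact space all of whose Gram sums are nonnegative has
nonnegative double integral: integrate the Gram sum over `n` independent samples. -/
theorem integral_integral_nonneg_of_gram_sum_nonneg {X : Type*} [TopologicalSpace X]
    [CompactSpace X] [SecondCountableTopology X] [MeasurableSpace X] [BorelSpace X]
    (μ : Measure X) [IsProbabilityMeasure μ] (F : X → X → ℝ)
    (hF : Continuous fun p : X × X => F p.1 p.2)
    (hpos : ∀ (n : ℕ) (x : Fin n → X), 0 ≤ ∑ i, ∑ j, F (x i) (x j)) :
    0 ≤ ∫ z, ∫ w, F z w ∂μ ∂μ := by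
  have hintegrable : ∀ {Y : Type _} [MeasurableSpace Y] (P : Measure Y)
      [IsProbabilityMeasure P]
      (g : Y → X × X), Measurable g → Integrable (fun y => F (g y).1 (g y).2) P := by
    intro Y _ P _ g hg
    obtain ⟨C, hC⟩ := isCompact_univ.exists_bound_of_continuousOn hF.continuousOn
    exact Integrable.of_bound (hF.measurable.comp hg).aestronglyMeasurable C
      (Filter.Eventually.of_forall fun y => hC (g y) (Set.mem_univ _))
  have hprod : ∫ p, F p.1 p.2 ∂(μ.prod μ) = ∫ z, ∫ w, F z w ∂μ ∂μ :=
    integral_prod _ (hintegrable (μ.prod μ) id measurable_id)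
  rw [← hprod]
  set J := ∫ p, F p.1 p.2 ∂(μ.prod μ) with hJ
  set T := ∫ z, F z z ∂μ with hT
  have hineq : ∀ n : ℕ, 0 ≤ (n : ℝ) * (T - J) + (n : ℝ) * n * J := by
    intro n
    have hdiag : ∀ i : Fin n, ∫ x, F (x i) (x i) ∂(Measure.pi fun _ : Fin n => μ) = T := by
      intro i
      have hFd : Continuous fun z => F z z := hF.comp (continuous_id.prodMk continuous_id)
      have hmp := measurePreserving_eval (fun _ : Fin n => μ) i
      have hmap := integral_map (f := fun z => F z z) hmp.aemeasurable
        hFd.aestronglyMeasurable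
      rw [hmp.map_eq] at hmap
      exact hmap.symm
    have hoff : ∀ i j : Fin n, i ≠ j →
        ∫ x, F (x i) (x j) ∂(Measure.pi fun _ : Fin n => μ) = J := by
      intro i j hij
      have hind : iIndepFun (fun (i : Fin n) (x : Fin n → X) => x i)
          (Measure.pi fun _ : Fin n => μ) :=
        iIndepFun_pi (X := fun _ x => x) fun _ => aemeasurable_id
      have hmap := (indepFun_iff_map_prod_eq_prod_map_map
        (measurable_pi_apply i).aemeasurable (measurable_pi_apply j).aemeasurable).1
        (hind.indepFun hij)
      have hev : ∀ i : Fin n, (Measure.pi fun _ : Fin n => μ).map (fun x => x i) = μ :=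
        fun i => (measurePreserving_eval (fun _ : Fin n => μ) i).map_eq
      rw [hev, hev] at hmap
      rw [hJ, ← hmap, integral_map (by fun_prop) hF.aestronglyMeasurable]
    have hsum : ∫ x, ∑ i, ∑ j, F (x i) (x j) ∂(Measure.pi fun _ : Fin n => μ) =
        (n : ℝ) * (T - J) + (n : ℝ) * n * J := by
      have hI : ∀ i j : Fin n,
          Integrable (fun x => F (x i) (x j)) (Measure.pi fun _ : Fin n => μ) :=
        fun i j => hintegrable _ (fun x : Fin n → X => (x i, x j)) (by fun_prop)
      rw [integral_finsetSum _ fun i _ => integrable_finsetSum _ fun j _ => hI i j]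
      have hval : ∀ i j : Fin n, ∫ x, F (x i) (x j) ∂(Measure.pi fun _ : Fin n => μ) =
          (if i = j then T - J else 0) + J := by
        intro i j
        split_ifs with h
        · subst h
          rw [hdiag]; ring
        · rw [hoff i j h]; ring
      simp only [integral_finsetSum _ fun j _ => hI _ j, hval, Finset.sum_add_distrib,
        Finset.sum_ite_eq, Finset.mem_univ, if_true, Finset.sum_const, Finset.card_univ,
        Fintype.card_fin, nsmul_eq_mul]
      ring
    rw [← hsum]
    exact integral_nonneg fun x => hpos n x
  by_contra! hneg
  obtain ⟨n, hn⟩ := exists_nat_gt ((T - J) / (-J))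
  rw [div_lt_iff₀ (by linarith)] at hn
  have h := hineq (n + 1)
  push_cast at h
  have hn0 : (0 : ℝ) ≤ n := n.cast_nonneg
  nlinarith

/-- The double average of a kernel over the coordinates outside `u` and `v`. -/
noncomputable def kernelAverage {d : ℕ} (D : Fin d → Set ℝ) (ν : ∀ i, Measure (D i))
    (k : (∀ i, D i) → (∀ i, D i) → ℝ) (u v : Finset (Fin d)) (x y : ∀ i, D i) : ℝ :=
  ∫ z, (∫ w, k (combine D u x z) (combine D v y w) ∂(Measure.pi ν)) ∂(Measure.pi ν)

theorem continuous_combine {d : ℕ} (D : Fin d → Set ℝ) (u : Finset (Fin d)) (x : ∀ i, D i) :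
    Continuous (combine D u x) := by
  refine continuous_pi fun j => ?_
  unfold combine
  split_ifs <;> fun_prop

/-- The total coefficient of the average over the coordinates outside `u'` in the
projection with weights `α`. -/
noncomputable def averageCoeff {d : ℕ} (α : Finset (Fin d) → ℝ) (u' : Finset (Fin d)) : ℝ :=
  ∑ u, α u * if u' ⊆ u then (-1 : ℝ) ^ (u.card - u'.card) else 0

theorem kanova_eq_sum_kernelAverage {d : ℕ} (D : Fin d → Set ℝ) (ν : ∀ i, Measure (D i))
    (k : (∀ i, D i) → (∀ i, D i) → ℝ) (u v : Finset (Fin d)) (x y : ∀ i, D i) :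
    kanova D ν u v k x y = ∑ u', ∑ v',
      (if u' ⊆ u then (-1 : ℝ) ^ (u.card - u'.card) else 0) *
      (if v' ⊆ v then (-1 : ℝ) ^ (v.card - v'.card) else 0) *
      kernelAverage D ν k u' v' x y := by
  have hpow : ∀ (s : Finset (Fin d)) (f : Finset (Fin d) → ℝ),
      ∑ t ∈ s.powerset, f t = ∑ t, if t ⊆ s then f t else 0 := by
    intro s f
    rw [← Finset.sum_filter]
    congr 1
    ext t
    simp
  simp only [kanova, hpow]
  refine Finset.sum_congr rfl fun u' _ => ?_
  split_ifs with hu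
  · refine Finset.sum_congr rfl fun v' _ => ?_
    split_ifs with hv
    · have h₁ := Finset.card_le_card hu
      have h₂ := Finset.card_le_card hv
      rw [← pow_add, kernelAverage]
      congr 2
      omega
    · simp
  · simp

theorem sum_kanova_eq_sum_kernelAverage {d : ℕ} (D : Fin d → Set ℝ)
    (ν : ∀ i, Measure (D i)) (k : (∀ i, D i) → (∀ i, D i) → ℝ) (α : Finset (Fin d) → ℝ)
    (x y : ∀ i, D i) :
    ∑ u, ∑ v, α u * α v * kanova D ν u v k x y =
      ∑ u', ∑ v', averageCoeff α u' * averageCoeff α v' * kernelAverage D ν k u' v' x y := by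
  let γ : Finset (Fin d) → Finset (Fin d) → ℝ :=
    fun u u' => if u' ⊆ u then (-1 : ℝ) ^ (u.card - u'.card) else 0
  let g : Finset (Fin d) × Finset (Fin d) → Finset (Fin d) × Finset (Fin d) → ℝ :=
    fun p q => α p.1 * γ p.1 q.1 * (α p.2 * γ p.2 q.2) * kernelAverage D ν k q.1 q.2 x y
  trans ∑ p, ∑ q, g p q
  · simp only [Fintype.sum_prod_type, kanova_eq_sum_kernelAverage, Finset.mul_sum, g, γ]
    exact Finset.sum_congr rfl fun u _ => Finset.sum_congr rfl fun v _ =>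
      Finset.sum_congr rfl fun u' _ => Finset.sum_congr rfl fun v' _ => by ring
  · rw [Finset.sum_comm]
    simp only [Fintype.sum_prod_type, averageCoeff, Finset.sum_mul_sum]
    simp only [Finset.sum_mul, g, γ]

theorem gram_sum_nonneg_of_fintype {X ι : Type*} [Fintype ι] (k : X → X → ℝ)
    (hk : ∀ (n : ℕ) (x : Fin n → X) (c : Fin n → ℝ),
      0 ≤ ∑ i : Fin n, ∑ j : Fin n, c i * c j * k (x i) (x j))
    (x : ι → X) (c : ι → ℝ) : 0 ≤ ∑ i, ∑ j, c i * c j * k (x i) (x j) := by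
  have e := (Fintype.equivFin ι).symm
  convert hk _ (x ∘ e) (c ∘ e) using 1
  simp only [Function.comp_apply]
  rw [← e.sum_comp]
  exact Finset.sum_congr rfl fun i _ => (e.sum_comp _).symm

/-- If each `D_i` is compact and `k` is a continuous symmetric positive definite kernel
on `D × D`, then for any reals `(α_u)_{u⊆I}` the function
`(x,y) ↦ ∑_{u⊆I} ∑_{v⊆I} α_u α_v k_{u,v}(x,y)` is again a symmetric positive definite
kernel. -/
theorem kanova_projected_kernel_spd {d : ℕ} (hd : 1 ≤ d)
    (D : Fin d → Set ℝ) (hDcomp : ∀ i, IsCompact (D i))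
    (ν : ∀ i, Measure (D i)) [∀ i, IsProbabilityMeasure (ν i)]
    (k : (∀ i, D i) → (∀ i, D i) → ℝ)
    (hk_cont : Continuous (fun p : (∀ i, D i) × (∀ i, D i) => k p.1 p.2))
    (hk_symm : ∀ x y : ∀ i, D i, k x y = k y x)
    (hk_pd : ∀ (n : ℕ) (x : Fin n → ∀ i, D i) (c : Fin n → ℝ),
      0 ≤ ∑ i : Fin n, ∑ j : Fin n, c i * c j * k (x i) (x j))
    (α : Finset (Fin d) → ℝ) :
    (∀ x y : ∀ i, D i,
      (∑ u : Finset (Fin d), ∑ v : Finset (Fin d), α u * α v * kanova D ν u v k x y) =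
      (∑ u : Finset (Fin d), ∑ v : Finset (Fin d), α u * α v * kanova D ν u v k y x))
    ∧
    (∀ (n : ℕ) (x : Fin n → ∀ i, D i) (c : Fin n → ℝ),
      0 ≤ ∑ i : Fin n, ∑ j : Fin n, c i * c j *
        ∑ u : Finset (Fin d), ∑ v : Finset (Fin d),
          α u * α v * kanova D ν u v k (x i) (x j)) := by
  have : ∀ i, CompactSpace (D i) := fun i => isCompact_iff_compactSpace.1 (hDcomp i)
  have hcont : ∀ (u v : Finset (Fin d)) (x y : ∀ i, D i), Continuous
      fun p : (∀ i, D i) × (∀ i, D i) => k (combine D u x p.1) (combine D v y p.2) :=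
    fun u v x y => hk_cont.comp (((continuous_combine D u x).comp continuous_fst).prodMk
      ((continuous_combine D v y).comp continuous_snd))
  have hintegrable : ∀ f : (∀ i, D i) × (∀ i, D i) → ℝ, Continuous f →
      Integrable f ((Measure.pi ν).prod (Measure.pi ν)) := fun f hf =>
    hf.integrable_of_hasCompactSupport (HasCompactSupport.of_compactSpace f)
  have havg : ∀ u v x y, kernelAverage D ν k u v x y = ∫ p : (∀ i, D i) × (∀ i, D i),
      k (combine D u x p.1) (combine D v y p.2) ∂((Measure.pi ν).prod (Measure.pi ν)) :=
    fun u v x y => (integral_prod _ (hintegrable _ (hcont u v x y))).symm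
  simp only [sum_kanova_eq_sum_kernelAverage]
  constructor
  · intro x y
    rw [Finset.sum_comm]
    refine Finset.sum_congr rfl fun u _ => Finset.sum_congr rfl fun v _ => ?_
    rw [mul_comm (averageCoeff α v)]
    congr 1
    rw [havg, havg, ← integral_prod_swap]
    exact integral_congr_ae (Filter.Eventually.of_forall fun p => hk_symm _ _)
  · intro n x c
    let a : Fin n × Finset (Fin d) → ℝ := fun A => c A.1 * averageCoeff α A.2
    let F : (∀ i, D i) → (∀ i, D i) → ℝ := fun z w => ∑ A, ∑ B,
      a A * a B * k (combine D A.2 (x A.1) z) (combine D B.2 (x B.1) w)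
    have hFcont : Continuous fun p : (∀ i, D i) × (∀ i, D i) => F p.1 p.2 :=
      continuous_finsetSum _ fun A _ => continuous_finsetSum _ fun B _ =>
        continuous_const.mul (hcont _ _ _ _)
    have hFpos : ∀ (m : ℕ) (z : Fin m → ∀ i, D i), 0 ≤ ∑ i, ∑ j, F (z i) (z j) := by
      intro m z
      have h := gram_sum_nonneg_of_fintype k hk_pd
        (fun q : Fin m × (Fin n × Finset (Fin d)) => combine D q.2.2 (x q.2.1) (z q.1))
        (fun q => a q.2)
      simp only [Fintype.sum_prod_type (α₁ := Fin m)] at h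
      refine h.trans_eq (Finset.sum_congr rfl fun i _ => ?_)
      rw [Finset.sum_comm]
    have h := integral_integral_nonneg_of_gram_sum_nonneg (Measure.pi ν) F hFcont hFpos
    have hFint : ∫ z, ∫ w, F z w ∂(Measure.pi ν) ∂(Measure.pi ν) =
        ∑ A, ∑ B, a A * a B * kernelAverage D ν k A.2 B.2 (x A.1) (x B.1) := by
      rw [← integral_prod (fun p : (∀ i, D i) × (∀ i, D i) => F p.1 p.2) (hintegrable _ hFcont)]
      have hI : ∀ A B : Fin n × Finset (Fin d), Integrable
          (fun p : (∀ i, D i) × (∀ i, D i) =>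
            a A * a B * k (combine D A.2 (x A.1) p.1) (combine D B.2 (x B.1) p.2))
          ((Measure.pi ν).prod (Measure.pi ν)) :=
        fun A B => (hintegrable _ (hcont _ _ _ _)).const_mul _
      rw [integral_finsetSum _ fun A _ => integrable_finsetSum _ fun B _ => hI A B]
      refine Finset.sum_congr rfl fun A _ => ?_
      rw [integral_finsetSum _ fun B _ => hI A B]
      exact Finset.sum_congr rfl fun B _ => by rw [integral_const_mul, havg]
    rw [hFint] at h
    simp only [Fintype.sum_prod_type] at h
    refine h.trans_eq (Finset.sum_congr rfl fun i _ => ?_)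
    rw [Finset.sum_comm]
    refine Finset.sum_congr rfl fun j _ => ?_
    simp only [Finset.mul_sum]
    exact Finset.sum_congr rfl fun u _ => Finset.sum_congr rfl fun v _ => by
      simp only [a]; ring
end

section
/- Suppose each D_i is a compact subset of ℝ and for each i ∈ I let k_i^{(0)} : D_i × D_i → ℝ be continuous and argumentwise centred, i.e. ∫ k_i^{(0)}(s,t) ν_i(dt) = 0 for every s ∈ D_i and ∫ k_i^{(0)}(s,t) ν_i(ds) = 0 for every t ∈ D_i. Define k(x,y) = ∏_{i=1}^d (1 + k_i^{(0)}(x_i, y_i)). Then for every u ⊆ I the KANOVA term satisfies k_{u,u}(x,y) = ∏_{i∈u} k_i^{(0)}(x_i, y_i) for all (x,y) ∈ D×D, and k_{u,v}(x,y) = 0 for all (x,y) ∈ D×D whenever u ≠ v. -/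
open MeasureTheory Finset

/-- Inclusion-exclusion: the alternating sum of the supersets of `w` in `u` detects `w = u`. -/
lemma sum_powerset_neg_one_pow_ite_subset {α : Type*} [DecidableEq α] (u w : Finset α) :
    ∑ t ∈ u.powerset, (-1 : ℝ) ^ (u.card - t.card) * (if w ⊆ t then 1 else 0) =
      if w = u then 1 else 0 := by
  by_cases hw : w ⊆ u
  · have h := Finset.prod_add (fun _ : α => (1 : ℝ)) (fun i => -(if i ∈ w then 0 else 1)) u
    have hl : ∏ i ∈ u, ((1 : ℝ) + -(if i ∈ w then 0 else 1)) = if w = u then 1 else 0 := by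
      have : ∀ i ∈ u, ((1 : ℝ) + -(if i ∈ w then 0 else 1)) = if i ∈ w then 1 else 0 := by
        intro i _
        split_ifs <;> norm_num
      rw [Finset.prod_congr rfl this, Finset.prod_ite_zero]
      simp only [Finset.prod_const_one]
      exact if_congr ⟨fun h => hw.antisymm h, fun h => h ▸ fun _ => id⟩ rfl rfl
    rw [← hl, h]
    refine Finset.sum_congr rfl fun t ht => ?_
    have ht' := Finset.mem_powerset.1 ht
    rw [Finset.prod_const_one, one_mul, Finset.prod_neg, Finset.card_sdiff_of_subset ht']
    congr 1
    have : ∀ i ∈ u \ t, (if i ∈ w then (0 : ℝ) else 1) = if i ∉ w then 1 else 0 := by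
      intro i _
      split_ifs <;> simp_all
    rw [Finset.prod_congr rfl this, Finset.prod_ite_zero]
    simp only [Finset.prod_const_one]
    refine if_congr ⟨fun h i hi hiw => (Finset.mem_sdiff.1 hi).2 (h hiw), fun h i hi => ?_⟩ rfl rfl
    by_contra hit
    exact h i (Finset.mem_sdiff.2 ⟨hw hi, hit⟩) hi
  · rw [if_neg (fun h => hw h.subset)]
    refine Finset.sum_eq_zero fun t ht => ?_
    rw [if_neg (fun h => hw (h.trans (Finset.mem_powerset.1 ht))), mul_zero]

/-- Double inclusion-exclusion for subset sums over intersections. -/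
lemma sum_powerset_neg_one_pow_prod_one_add {α : Type*} [Fintype α] [DecidableEq α]
    (u v : Finset α) (a : α → ℝ) :
    ∑ u' ∈ u.powerset, ∑ v' ∈ v.powerset,
      (-1 : ℝ) ^ (u.card + v.card - u'.card - v'.card) * ∏ i ∈ u' ∩ v', (1 + a i) =
      if u = v then ∏ i ∈ u, a i else 0 := by
  have hterm : ∀ u' ∈ u.powerset, ∀ v' ∈ v.powerset,
      (-1 : ℝ) ^ (u.card + v.card - u'.card - v'.card) * ∏ i ∈ u' ∩ v', (1 + a i) =
      ∑ w : Finset α, (∏ i ∈ w, a i) *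
        (((-1 : ℝ) ^ (u.card - u'.card) * (if w ⊆ u' then 1 else 0)) *
        ((-1 : ℝ) ^ (v.card - v'.card) * (if w ⊆ v' then 1 else 0))) := by
    intro u' hu v' hv
    have hu' := Finset.card_le_card (Finset.mem_powerset.1 hu)
    have hv' := Finset.card_le_card (Finset.mem_powerset.1 hv)
    have he : u.card + v.card - u'.card - v'.card =
        (u.card - u'.card) + (v.card - v'.card) := by omega
    have hp : (u' ∩ v').powerset = Finset.univ.filter (fun w => w ⊆ u' ∧ w ⊆ v') := by
      ext w
      simp only [Finset.mem_powerset, Finset.subset_inter_iff, Finset.mem_filter, Finset.mem_univ,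
        true_and]
    rw [he, pow_add, Finset.prod_one_add, hp, Finset.sum_filter, Finset.mul_sum]
    refine Finset.sum_congr rfl fun w _ => ?_
    by_cases h1 : w ⊆ u' <;> by_cases h2 : w ⊆ v' <;> simp [h1, h2, mul_comm]
  rw [Finset.sum_congr rfl fun u' hu => Finset.sum_congr rfl (hterm u' hu)]
  simp_rw [Finset.sum_comm (s := v.powerset)]
  rw [Finset.sum_comm]
  simp_rw [← Finset.mul_sum, ← Finset.sum_mul, sum_powerset_neg_one_pow_ite_subset]
  rw [Finset.sum_eq_single u]
  · split_ifs <;> simp_all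
  · intro w _ hw
    simp [hw]
  · simp

/-- The double integral of the product kernel with frozen coordinates keeps only the factors
whose two arguments are both frozen. -/
lemma integral_integral_prod_one_add_combine {d : ℕ} (D : Fin d → Set ℝ)
    (ν : ∀ i, Measure (D i)) [∀ i, IsProbabilityMeasure (ν i)]
    (k0 : ∀ i : Fin d, D i → D i → ℝ)
    (hint₁ : ∀ i, ∀ s : D i, Integrable (fun t => k0 i s t) (ν i))
    (hint₂ : ∀ i, ∀ t : D i, Integrable (fun s => k0 i s t) (ν i))
    (hcent₁ : ∀ i, ∀ s : D i, ∫ t, k0 i s t ∂(ν i) = 0)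
    (hcent₂ : ∀ i, ∀ t : D i, ∫ s, k0 i s t ∂(ν i) = 0)
    (u v : Finset (Fin d)) (x y : ∀ i, D i) :
    ∫ z, (∫ w, ∏ i, (1 + k0 i (combine D u x z i) (combine D v y w i)) ∂(Measure.pi ν))
      ∂(Measure.pi ν) = ∏ i ∈ u ∩ v, (1 + k0 i (x i) (y i)) := by
  have hinner : ∀ z : ∀ i, D i,
      ∫ w, ∏ i, (1 + k0 i (combine D u x z i) (combine D v y w i)) ∂(Measure.pi ν) =
      ∏ i, (if i ∈ v then 1 + k0 i (if i ∈ u then x i else z i) (y i) else 1) := by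
    intro z
    have h := integral_fintype_prod_eq_prod (μ := ν) (𝕜 := ℝ)
      (fun i (t : D i) => 1 + k0 i (combine D u x z i) (if i ∈ v then y i else t))
    refine h.trans (Finset.prod_congr rfl fun i _ => ?_)
    by_cases hi : i ∈ v
    · simp [hi, combine]
    · simp only [hi, if_false]
      rw [integral_add (integrable_const _) (hint₁ i _), hcent₁]
      simp
  simp_rw [hinner]
  have h := integral_fintype_prod_eq_prod (μ := ν) (𝕜 := ℝ)
    (fun i (s : D i) => if i ∈ v then 1 + k0 i (if i ∈ u then x i else s) (y i) else 1)
  refine h.trans ?_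
  rw [← Finset.prod_subset (Finset.subset_univ (u ∩ v))]
  · refine Finset.prod_congr rfl fun i hi => ?_
    obtain ⟨hu, hv⟩ := Finset.mem_inter.1 hi
    simp [hu, hv]
  · intro i _ hi
    by_cases hv : i ∈ v
    · have hu : i ∉ u := fun hu => hi (Finset.mem_inter.2 ⟨hu, hv⟩)
      simp only [hu, hv, if_false, if_true]
      rw [integral_add (integrable_const _) (hint₂ i _), hcent₂]
      simp
    · simp [hv]

/-- **KANOVA of ANOVA kernels.**  If each `k_i⁰ : D_i × D_i → ℝ` is continuous and
argumentwise centred and `k(x,y) = ∏_{i=1}^d (1 + k_i⁰(x_i,y_i))`, then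
`k_{u,u}(x,y) = ∏_{i∈u} k_i⁰(x_i,y_i)` and `k_{u,v} = 0` for `u ≠ v`. -/
theorem kanova_anova_kernel {d : ℕ} (hd : 1 ≤ d)
    (D : Fin d → Set ℝ) (hDcomp : ∀ i, IsCompact (D i))
    (ν : ∀ i, Measure (D i)) [∀ i, IsProbabilityMeasure (ν i)]
    (k0 : ∀ i : Fin d, D i → D i → ℝ)
    (hk0_cont : ∀ i, Continuous (fun p : D i × D i => k0 i p.1 p.2))
    (hk0_cent₁ : ∀ i, ∀ s : D i, ∫ t, k0 i s t ∂(ν i) = 0)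
    (hk0_cent₂ : ∀ i, ∀ t : D i, ∫ s, k0 i s t ∂(ν i) = 0)
    (k : (∀ i, D i) → (∀ i, D i) → ℝ)
    (hk : ∀ x y : ∀ i, D i, k x y = ∏ i : Fin d, (1 + k0 i (x i) (y i))) :
    (∀ u : Finset (Fin d), ∀ x y : ∀ i, D i,
      kanova D ν u u k x y = ∏ i ∈ u, k0 i (x i) (y i))
    ∧
    (∀ u v : Finset (Fin d), u ≠ v → ∀ x y : ∀ i, D i,
      kanova D ν u v k x y = 0) := by
  have hcompact : ∀ i, CompactSpace (D i) := fun i => isCompact_iff_compactSpace.1 (hDcomp i)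
  have hint₁ : ∀ i, ∀ s : D i, Integrable (fun t => k0 i s t) (ν i) := fun i s =>
    ((hk0_cont i).comp (Continuous.prodMk_right s)).integrable_of_hasCompactSupport
      (HasCompactSupport.of_compactSpace _)
  have hint₂ : ∀ i, ∀ t : D i, Integrable (fun s => k0 i s t) (ν i) := fun i t =>
    ((hk0_cont i).comp (Continuous.prodMk_left t)).integrable_of_hasCompactSupport
      (HasCompactSupport.of_compactSpace _)
  have key : ∀ u v : Finset (Fin d), ∀ x y : ∀ i, D i,
      kanova D ν u v k x y = if u = v then ∏ i ∈ u, k0 i (x i) (y i) else 0 := by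
    intro u v x y
    simp only [kanova, hk, integral_integral_prod_one_add_combine D ν k0 hint₁ hint₂
      hk0_cent₁ hk0_cent₂]
    exact sum_powerset_neg_one_pow_prod_one_add u v fun i => k0 i (x i) (y i)
  exact ⟨fun u x y => by rw [key, if_pos rfl], fun u v h x y => by rw [key, if_neg h]⟩
end

section
/- Let d = 1, D = [0,1] equipped with Lebesgue measure ν, and let k(x,y) = min(x,y) be the Brownian covariance kernel. Then the KANOVA terms of k are: k_{∅,∅}(x,y) = 1/3; k_{∅,{1}}(x,y) = y − y²/2 − 1/3; k_{{1},∅}(x,y) = x − x²/2 − 1/3; and k_{{1},{1}}(x,y) = min(x,y) − x + x²/2 − y + y²/2 + 1/3, for all x, y ∈ [0,1]. -/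
open MeasureTheory Finset

theorem integral_pi_fin_one_Icc (g : ℝ → ℝ) :
    ∫ z, g (z 0 : ℝ)
        ∂(Measure.pi fun _ : Fin 1 => (volume : Measure (Set.Icc (0 : ℝ) 1))) =
      ∫ t in (0 : ℝ)..1, g t := by
  rw [intervalIntegral.integral_of_le zero_le_one, ← integral_Icc_eq_integral_Ioc,
    ← integral_subtype measurableSet_Icc]
  exact (measurePreserving_funUnique (volume : Measure (Set.Icc (0 : ℝ) 1)) (Fin 1)).integral_comp
    (MeasurableEquiv.measurableEmbedding _) fun t => g t

theorem intervalIntegral_min_left {a : ℝ} (ha : a ∈ Set.Icc (0 : ℝ) 1) :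
    ∫ t in (0 : ℝ)..1, min a t = a - a ^ 2 / 2 := by
  have hc : Continuous fun t : ℝ => min a t := by fun_prop
  rw [← intervalIntegral.integral_add_adjacent_intervals
    (hc.intervalIntegrable 0 a) (hc.intervalIntegrable a 1)]
  have hl : ∫ t in (0 : ℝ)..a, min a t = ∫ t in (0 : ℝ)..a, t := by
    refine intervalIntegral.integral_congr fun t ht => ?_
    rw [Set.uIcc_of_le ha.1] at ht
    exact min_eq_right ht.2
  have hr : ∫ t in a..(1 : ℝ), min a t = ∫ _ in a..(1 : ℝ), a := by
    refine intervalIntegral.integral_congr fun t ht => ?_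
    rw [Set.uIcc_of_le ha.2] at ht
    exact min_eq_left ht.1
  rw [hl, hr, integral_id, intervalIntegral.integral_const, smul_eq_mul]
  ring

theorem intervalIntegral_id_sub_sq_div_two :
    ∫ t in (0 : ℝ)..1, (t - t ^ 2 / 2) = 1 / 3 := by
  rw [intervalIntegral.integral_sub (Continuous.intervalIntegrable (by fun_prop) _ _)
    (Continuous.intervalIntegrable (by fun_prop) _ _), intervalIntegral.integral_div,
    integral_id, integral_pow]
  norm_num

theorem combine_empty {d : ℕ} (D : Fin d → Set ℝ) (x z : ∀ i, D i) :
    combine D ∅ x z = z := by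
  ext j
  simp [combine]

theorem combine_singleton_zero (D : Fin 1 → Set ℝ) (x z : ∀ i, D i) :
    combine D {0} x z = x := by
  ext j
  simp [combine, Subsingleton.elim j 0]

/-- **KANOVA decomposition of the Brownian kernel** `k(x,y) = min(x,y)` on `D = [0,1]`
(`d = 1`) with `ν` the Lebesgue (uniform) measure on `[0,1]`:
`k_{∅,∅} = 1/3`, `k_{∅,{1}}(y) = y − y²/2 − 1/3`, `k_{{1},∅}(x) = x − x²/2 − 1/3`, and
`k_{{1},{1}}(x,y) = min(x,y) − x + x²/2 − y + y²/2 + 1/3`. -/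
theorem kanova_brownian_kernel
    (k : (∀ _ : Fin 1, (Set.Icc (0:ℝ) 1 : Set ℝ)) →
         (∀ _ : Fin 1, (Set.Icc (0:ℝ) 1 : Set ℝ)) → ℝ)
    (hk : ∀ x y, k x y = min (x 0 : ℝ) (y 0 : ℝ)) :
    ∀ x y : ∀ _ : Fin 1, (Set.Icc (0:ℝ) 1 : Set ℝ),
      kanova (fun _ => Set.Icc (0:ℝ) 1) (fun _ => (volume : Measure (Set.Icc (0:ℝ) 1)))
          (∅ : Finset (Fin 1)) (∅ : Finset (Fin 1)) k x y = 1 / 3 ∧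
      kanova (fun _ => Set.Icc (0:ℝ) 1) (fun _ => (volume : Measure (Set.Icc (0:ℝ) 1)))
          (∅ : Finset (Fin 1)) ({0} : Finset (Fin 1)) k x y =
        (y 0 : ℝ) - (y 0 : ℝ) ^ 2 / 2 - 1 / 3 ∧
      kanova (fun _ => Set.Icc (0:ℝ) 1) (fun _ => (volume : Measure (Set.Icc (0:ℝ) 1)))
          ({0} : Finset (Fin 1)) (∅ : Finset (Fin 1)) k x y =
        (x 0 : ℝ) - (x 0 : ℝ) ^ 2 / 2 - 1 / 3 ∧
      kanova (fun _ => Set.Icc (0:ℝ) 1) (fun _ => (volume : Measure (Set.Icc (0:ℝ) 1)))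
          ({0} : Finset (Fin 1)) ({0} : Finset (Fin 1)) k x y =
        min (x 0 : ℝ) (y 0 : ℝ) - (x 0 : ℝ) + (x 0 : ℝ) ^ 2 / 2
          - (y 0 : ℝ) + (y 0 : ℝ) ^ 2 / 2 + 1 / 3 := by
  intro x y
  have hmin (a : Set.Icc (0 : ℝ) 1) :
      ∫ w, min (a : ℝ) (w 0 : ℝ)
        ∂(Measure.pi fun _ : Fin 1 => (volume : Measure (Set.Icc (0 : ℝ) 1))) =
        (a : ℝ) - (a : ℝ) ^ 2 / 2 :=
    (integral_pi_fin_one_Icc fun t => min (a : ℝ) t).trans (intervalIntegral_min_left a.2)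
  have hmin' (a : Set.Icc (0 : ℝ) 1) :
      ∫ z, min (z 0 : ℝ) (a : ℝ)
        ∂(Measure.pi fun _ : Fin 1 => (volume : Measure (Set.Icc (0 : ℝ) 1))) =
        (a : ℝ) - (a : ℝ) ^ 2 / 2 := by
    simpa only [min_comm] using hmin a
  have hsq : ∫ z, ((z 0 : ℝ) - (z 0 : ℝ) ^ 2 / 2)
      ∂(Measure.pi fun _ : Fin 1 => (volume : Measure (Set.Icc (0 : ℝ) 1))) = 1 / 3 :=
    (integral_pi_fin_one_Icc fun t => t - t ^ 2 / 2).trans intervalIntegral_id_sub_sq_div_two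
  have hpow : ({0} : Finset (Fin 1)).powerset = {∅, {0}} := rfl
  have hne : (∅ : Finset (Fin 1)) ≠ {0} := (singleton_ne_empty 0).symm
  refine ⟨?_, ?_, ?_, ?_⟩ <;>
    simp only [kanova, hpow, powerset_empty, sum_singleton, sum_pair hne, combine_empty,
      combine_singleton_zero, hk, hmin, integral_const, probReal_univ, smul_eq_mul, one_mul,
      card_empty, card_singleton] <;>
    simp only [hmin', hsq] <;>
    ring
end

section
/- Let (Ω,𝒜,ℙ) be a probability space and Z : Ω × D → ℝ a jointly measurable stochastic process such that x ↦ Z(ω,x) is continuous for every ω ∈ Ω, E[Z_x] = 0 for every x ∈ D, and such that the covariance kernel k(x,y) = E[Z_x Z_y] is continuous on D×D. Then for all u, v ⊆ I and all x, y ∈ D, the pathwise FANOVA effects satisfy Cov(Z^{(u)}_x, Z^{(v)}_y) = E[Z^{(u)}_x Z^{(v)}_y] = k_{u,v}(x,y), where k_{u,v} is the KANOVA term of k. -/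
open MeasureTheory Finset

/-- FANOVA projection `T_u f (x) = ∑_{u'⊆u} (−1)^{|u|−|u'|} ∫ f(x) ν_{−u'}(dx_{−u'})`,
where integration over the coordinates outside `u'` is realized by integrating over the
full product probability measure `Measure.pi ν` with the coordinates in `u'` fixed. -/
noncomputable def Tproj {d : ℕ} (D : Fin d → Set ℝ) (ν : ∀ i, Measure (D i))
    (u : Finset (Fin d)) (f : (∀ i, D i) → ℝ) : (∀ i, D i) → ℝ :=
  fun x => ∑ u' ∈ u.powerset, (-1 : ℝ) ^ (u.card - u'.card) *
    ∫ z, f (combine D u' x z) ∂(Measure.pi ν)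

/-- Substituting fixed coordinates is measurable in the integrated coordinates. -/
theorem measurable_combine {d : ℕ} (D : Fin d → Set ℝ) (u : Finset (Fin d)) (x : ∀ i, D i) :
    Measurable (combine D u x) := by
  refine measurable_pi_lambda _ fun j => ?_
  by_cases hj : j ∈ u
  · simp only [combine, hj, if_true]
    exact measurable_const
  · simp only [combine, hj, if_false]
    exact measurable_pi_apply j

section SecondOrder

variable {Ω E X : Type*} [MeasurableSpace Ω] [MeasurableSpace E] [MeasurableSpace X]
  {P : Measure Ω} [IsProbabilityMeasure P] {Z : Ω → E → ℝ}

/-- A measurable process with bounded second moments is jointly square integrable along any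
measurable random index. -/
theorem memLp_two_comp_prod (ρ : Measure X) [IsProbabilityMeasure ρ]
    (hZ : Measurable (fun p : Ω × E => Z p.1 p.2))
    (hsq : ∀ x, Integrable (fun ω => Z ω x * Z ω x) P)
    {C : ℝ} (hC : ∀ x, ∫ ω, Z ω x * Z ω x ∂P ≤ C) {φ : X → E} (hφ : Measurable φ) :
    MemLp (fun p : Ω × X => Z p.1 (φ p.2)) 2 (P.prod ρ) := by
  have hm : Measurable (fun p : Ω × X => Z p.1 (φ p.2)) :=
    hZ.comp (measurable_fst.prodMk (hφ.comp measurable_snd))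
  rw [memLp_two_iff_integrable_sq hm.aestronglyMeasurable]
  have hm2 : AEStronglyMeasurable (fun p : Ω × X => Z p.1 (φ p.2) ^ 2) (P.prod ρ) :=
    (hm.pow_const 2).aestronglyMeasurable
  rw [integrable_prod_iff' hm2]
  refine ⟨.of_forall fun y => by simpa only [sq] using hsq (φ y), ?_⟩
  refine Integrable.of_bound hm2.norm.prod_swap.integral_prod_right' C (.of_forall fun y => ?_)
  rw [Real.norm_of_nonneg (integral_nonneg fun _ => norm_nonneg _)]
  simpa only [Prod.fst_swap, Prod.snd_swap, Real.norm_eq_abs, sq, abs_mul_self]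
    using hC (φ y)

variable (μ : Measure X) [IsProbabilityMeasure μ]

/-- The average of a second-order process over a random index is integrable. -/
theorem integrable_integral_comp
    (hZ : Measurable (fun p : Ω × E => Z p.1 p.2))
    (hsq : ∀ x, Integrable (fun ω => Z ω x * Z ω x) P)
    {C : ℝ} (hC : ∀ x, ∫ ω, Z ω x * Z ω x ∂P ≤ C) {φ : X → E} (hφ : Measurable φ) :
    Integrable (fun ω => ∫ z, Z ω (φ z) ∂μ) P :=
  ((memLp_two_comp_prod μ hZ hsq hC hφ).integrable one_le_two).integral_prod_left

/-- Expectation commutes with averaging a second-order process over a random index. -/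
theorem integral_integral_comp
    (hZ : Measurable (fun p : Ω × E => Z p.1 p.2))
    (hsq : ∀ x, Integrable (fun ω => Z ω x * Z ω x) P)
    {C : ℝ} (hC : ∀ x, ∫ ω, Z ω x * Z ω x ∂P ≤ C) {φ : X → E} (hφ : Measurable φ) :
    ∫ ω, ∫ z, Z ω (φ z) ∂μ ∂P = ∫ z, ∫ ω, Z ω (φ z) ∂P ∂μ :=
  integral_integral_swap ((memLp_two_comp_prod μ hZ hsq hC hφ).integrable one_le_two)

/-- Two copies of a second-order process, evaluated along independent random indices, have a
jointly integrable product. -/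
theorem integrable_mul_comp_prod
    (hZ : Measurable (fun p : Ω × E => Z p.1 p.2))
    (hsq : ∀ x, Integrable (fun ω => Z ω x * Z ω x) P)
    {C : ℝ} (hC : ∀ x, ∫ ω, Z ω x * Z ω x ∂P ≤ C)
    {φ ψ : X → E} (hφ : Measurable φ) (hψ : Measurable ψ) :
    Integrable (fun p : Ω × X × X => Z p.1 (φ p.2.1) * Z p.1 (ψ p.2.2))
      (P.prod (μ.prod μ)) :=
  (memLp_two_comp_prod (μ.prod μ) hZ hsq hC (hφ.comp measurable_fst)).integrable_mul
    (memLp_two_comp_prod (μ.prod μ) hZ hsq hC (hψ.comp measurable_snd))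

/-- The product of two averages of a second-order process is integrable. -/
theorem integrable_integral_mul_integral
    (hZ : Measurable (fun p : Ω × E => Z p.1 p.2))
    (hsq : ∀ x, Integrable (fun ω => Z ω x * Z ω x) P)
    {C : ℝ} (hC : ∀ x, ∫ ω, Z ω x * Z ω x ∂P ≤ C)
    {φ ψ : X → E} (hφ : Measurable φ) (hψ : Measurable ψ) :
    Integrable (fun ω => (∫ z, Z ω (φ z) ∂μ) * ∫ w, Z ω (ψ w) ∂μ) P := by
  have h := (integrable_mul_comp_prod μ hZ hsq hC hφ hψ).integral_prod_left
  refine h.congr (.of_forall fun ω => ?_)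
  exact integral_prod_mul (fun z => Z ω (φ z)) (fun w => Z ω (ψ w))

/-- The second moment of averages of a second-order process is the double average of its
second-moment kernel. -/
theorem integral_integral_mul_integral
    (hZ : Measurable (fun p : Ω × E => Z p.1 p.2))
    (hsq : ∀ x, Integrable (fun ω => Z ω x * Z ω x) P)
    {C : ℝ} (hC : ∀ x, ∫ ω, Z ω x * Z ω x ∂P ≤ C)
    {φ ψ : X → E} (hφ : Measurable φ) (hψ : Measurable ψ) :
    ∫ ω, (∫ z, Z ω (φ z) ∂μ) * (∫ w, Z ω (ψ w) ∂μ) ∂P =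
      ∫ z, ∫ w, ∫ ω, Z ω (φ z) * Z ω (ψ w) ∂P ∂μ ∂μ := by
  have h := integrable_mul_comp_prod μ hZ hsq hC hφ hψ
  calc ∫ ω, (∫ z, Z ω (φ z) ∂μ) * (∫ w, Z ω (ψ w) ∂μ) ∂P
      = ∫ ω, ∫ q : X × X, Z ω (φ q.1) * Z ω (ψ q.2) ∂(μ.prod μ) ∂P :=
        integral_congr_ae (.of_forall fun ω =>
          (integral_prod_mul (fun z => Z ω (φ z)) (fun w => Z ω (ψ w))).symm)
    _ = ∫ q : X × X, ∫ ω, Z ω (φ q.1) * Z ω (ψ q.2) ∂P ∂(μ.prod μ) :=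
        integral_integral_swap h
    _ = ∫ z, ∫ w, ∫ ω, Z ω (φ z) * Z ω (ψ w) ∂P ∂μ ∂μ :=
        integral_prod _ h.integral_prod_right

end SecondOrder

/-- **Covariance structure of the FANOVA effects of a centred random field.**
For a jointly measurable, centred process `Z` with continuous sample paths and
continuous covariance kernel `k(x,y) = E[Z_x Z_y]`, the pathwise FANOVA effects
`Z^{(u)} = T_u Z` are centred and satisfy
`Cov(Z^{(u)}_x, Z^{(v)}_y) = E[Z^{(u)}_x Z^{(v)}_y] = k_{u,v}(x, y)`. -/
theorem fanova_effects_covariance {d : ℕ} (hd : 1 ≤ d)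
    (a b : Fin d → ℝ) (hab : ∀ i, a i < b i)
    (D : Fin d → Set ℝ) (hD : ∀ i, D i = Set.Icc (a i) (b i))
    (ν : ∀ i, Measure (D i)) [∀ i, IsProbabilityMeasure (ν i)]
    {Ω : Type*} [MeasurableSpace Ω] (P : Measure Ω) [IsProbabilityMeasure P]
    (Z : Ω → (∀ i, D i) → ℝ)
    (hZ_meas : Measurable (fun p : Ω × (∀ i, D i) => Z p.1 p.2))
    (hZ_cont : ∀ ω, Continuous (Z ω))
    (hZ_int : ∀ x, Integrable (fun ω => Z ω x) P)
    (hZ_centred : ∀ x, ∫ ω, Z ω x ∂P = 0)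
    (hZ_sq_int : ∀ x y, Integrable (fun ω => Z ω x * Z ω y) P)
    (k : (∀ i, D i) → (∀ i, D i) → ℝ)
    (hk : ∀ x y, k x y = ∫ ω, Z ω x * Z ω y ∂P)
    (hk_cont : Continuous (fun p : (∀ i, D i) × (∀ i, D i) => k p.1 p.2)) :
    ∀ (u v : Finset (Fin d)) (x y : ∀ i, D i),
      -- the FANOVA effects are centred, hence covariance = expectation of the product
      (∫ ω, Tproj D ν u (Z ω) x ∂P = 0) ∧
      -- Cov(Z^{(u)}_x, Z^{(v)}_y) = E[Z^{(u)}_x Z^{(v)}_y]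
      (∫ ω, (Tproj D ν u (Z ω) x - ∫ ω', Tproj D ν u (Z ω') x ∂P) *
            (Tproj D ν v (Z ω) y - ∫ ω', Tproj D ν v (Z ω') y ∂P) ∂P =
        ∫ ω, Tproj D ν u (Z ω) x * Tproj D ν v (Z ω) y ∂P) ∧
      -- E[Z^{(u)}_x Z^{(v)}_y] = k_{u,v}(x,y)
      (∫ ω, Tproj D ν u (Z ω) x * Tproj D ν v (Z ω) y ∂P = kanova D ν u v k x y) := by
  have hDc : ∀ i, CompactSpace (D i) := fun i => by
    rw [hD i]
    infer_instance
  have hsq x : Integrable (fun ω => Z ω x * Z ω x) P := hZ_sq_int x x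
  obtain ⟨C, hC⟩ : ∃ C, ∀ x, ∫ ω, Z ω x * Z ω x ∂P ≤ C := by
    have hdiag : Continuous fun x => k x x := hk_cont.comp (continuous_id.prodMk continuous_id)
    obtain ⟨C, hC⟩ := (isCompact_range hdiag).bddAbove
    exact ⟨C, fun x => (hk x x).symm.trans_le (hC ⟨x, rfl⟩)⟩
  have hcentred (u : Finset (Fin d)) (x : ∀ i, D i) : ∫ ω, Tproj D ν u (Z ω) x ∂P = 0 := by
    unfold Tproj
    rw [integral_finsetSum _ fun u' _ => (integrable_integral_comp (Measure.pi ν) hZ_meas hsq hC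
      (measurable_combine D u' x)).const_mul _]
    refine Finset.sum_eq_zero fun u' _ => ?_
    rw [integral_const_mul, integral_integral_comp (Measure.pi ν) hZ_meas hsq hC
      (measurable_combine D u' x)]
    simp only [hZ_centred, integral_zero, mul_zero]
  intro u v x y
  refine ⟨hcentred u x, by simp only [hcentred, sub_zero], ?_⟩
  have hint (u' v' : Finset (Fin d)) := integrable_integral_mul_integral (Measure.pi ν) hZ_meas
    hsq hC (measurable_combine D u' x) (measurable_combine D v' y)
  simp only [Tproj, kanova, Finset.sum_mul_sum, mul_mul_mul_comm]
  rw [integral_finsetSum _ fun u' _ => integrable_finsetSum _ fun v' _ => (hint u' v').const_mul _]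
  refine Finset.sum_congr rfl fun u' hu' => ?_
  rw [integral_finsetSum _ fun v' _ => (hint u' v').const_mul _]
  refine Finset.sum_congr rfl fun v' hv' => ?_
  have hu := Finset.card_le_card (Finset.mem_powerset.1 hu')
  have hv := Finset.card_le_card (Finset.mem_powerset.1 hv')
  rw [integral_const_mul, integral_integral_mul_integral (Measure.pi ν) hZ_meas hsq hC
    (measurable_combine D u' x) (measurable_combine D v' y), ← pow_add,
    show u.card - u'.card + (v.card - v'.card) = u.card + v.card - u'.card - v'.card by omega]
  simp only [hk]
end

section
/- Let (Ω,𝒜,ℙ) be a probability space and Z : Ω × D → ℝ a jointly measurable stochastic process such that x ↦ Z(ω,x) is continuous for every ω ∈ Ω, E[Z_x] = 0 for every x ∈ D, and such that the covariance kernel k(x,y) = E[Z_x Z_y] is continuous on D×D. Then for every u ⊆ I the following are equivalent: (i) (T_u k(·,y))(x) = 0 for all x, y ∈ D; (ii) k_{u,u}(x,y) = 0 for all x, y ∈ D; (iii) k_{u,u}(x,x) = 0 for all x ∈ D; (iv) ℙ(Z^{(u)}(·,x) = 0 for all x ∈ D) = 1. Here T_u k(·,y) denotes T_u applied to the function x ↦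 k(x,y), and k_{u,u} is the KANOVA term of k. -/
open MeasureTheory Finset

namespace FanovaSparsity

section Measurable

variable {X Ω : Type*} [MeasurableSpace X] [MeasurableSpace Ω] {P : Measure Ω} {Z : Ω → X → ℝ}

/-- Jensen's inequality for the square. -/
lemma sq_integral_le {π : Measure X} [IsProbabilityMeasure π] {f : X → ℝ} (hf : MemLp f 2 π) :
    (∫ x, f x ∂π) ^ 2 ≤ ∫ x, f x ^ 2 ∂π := by
  have h := ProbabilityTheory.variance_nonneg f π
  rw [ProbabilityTheory.variance_eq_sub hf] at h
  simpa using h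

lemma memLp_two_section (hZ : Measurable fun p : Ω × X => Z p.1 p.2)
    (hsq : ∀ x, Integrable (fun ω => Z ω x * Z ω x) P) (x : X) :
    MemLp (fun ω => Z ω x) 2 P := by
  have hm : Measurable fun ω => Z ω x := hZ.comp measurable_prodMk_right
  rw [memLp_two_iff_integrable_sq hm.aestronglyMeasurable]
  simpa only [sq] using hsq x

lemma measurable_uncurry_comp [TopologicalSpace X] [BorelSpace X] {φ : X → X}
    (hZ : Measurable fun p : Ω × X => Z p.1 p.2) (hφ : Continuous φ) :
    Measurable fun p : Ω × X => Z p.1 (φ p.2) :=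
  hZ.comp (measurable_fst.prodMk (hφ.measurable.comp measurable_snd))

end Measurable

section SecondOrder

variable {X Ω : Type*} [TopologicalSpace X] [CompactSpace X] [MeasurableSpace X]
  [BorelSpace X] [MeasurableSpace Ω]
  {P : Measure Ω} [IsProbabilityMeasure P] {π : Measure X} [IsProbabilityMeasure π]
  {Z : Ω → X → ℝ} {φ : X → X}

/-- A continuous real function on a compact space is integrable for a probability measure. -/
lemma integrable_of_continuous {f : X → ℝ} (hf : Continuous f) : Integrable f π := by
  obtain ⟨C, hC⟩ := isCompact_univ.exists_bound_of_continuousOn hf.continuousOn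
  exact Integrable.of_bound hf.measurable.aestronglyMeasurable C
    (Filter.Eventually.of_forall fun x => hC x (Set.mem_univ x))

/-- Integrability of the squared process jointly in the sample and the parameter. -/
lemma integrable_sq_prod (hZ : Measurable fun p : Ω × X => Z p.1 p.2)
    (hsq : ∀ x, Integrable (fun ω => Z ω x * Z ω x) P)
    (hvar : Continuous fun x => ∫ ω, Z ω x * Z ω x ∂P) (hφ : Continuous φ) :
    Integrable (fun p : Ω × X => Z p.1 (φ p.2) ^ 2) (P.prod π) := by
  have hm := measurable_uncurry_comp hZ hφ
  rw [integrable_prod_iff' (hm.pow_const 2).aestronglyMeasurable]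
  refine ⟨Filter.Eventually.of_forall fun z => by simpa only [sq] using hsq (φ z), ?_⟩
  simp only [norm_pow, Real.norm_eq_abs, sq_abs]
  simpa only [sq, Function.comp_def] using integrable_of_continuous (π := π) (hvar.comp hφ)

lemma memLp_two_prod (hZ : Measurable fun p : Ω × X => Z p.1 p.2)
    (hsq : ∀ x, Integrable (fun ω => Z ω x * Z ω x) P)
    (hvar : Continuous fun x => ∫ ω, Z ω x * Z ω x ∂P) (hφ : Continuous φ) :
    MemLp (fun p : Ω × X => Z p.1 (φ p.2)) 2 (P.prod π) :=
  (memLp_two_iff_integrable_sq (measurable_uncurry_comp hZ hφ).aestronglyMeasurable).2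
    (integrable_sq_prod hZ hsq hvar hφ)

/-- Averaging a second-order process with continuous paths over its parameter yields a
square-integrable variable. -/
lemma memLp_two_integral (hZ : Measurable fun p : Ω × X => Z p.1 p.2)
    (hc : ∀ ω, Continuous (Z ω)) (hsq : ∀ x, Integrable (fun ω => Z ω x * Z ω x) P)
    (hvar : Continuous fun x => ∫ ω, Z ω x * Z ω x ∂P) (hφ : Continuous φ) :
    MemLp (fun ω => ∫ z, Z ω (φ z) ∂π) 2 P := by
  have hm : StronglyMeasurable fun ω => ∫ z, Z ω (φ z) ∂π :=
    (measurable_uncurry_comp hZ hφ).stronglyMeasurable.integral_prod_right'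
  rw [memLp_two_iff_integrable_sq hm.aestronglyMeasurable]
  refine (integrable_sq_prod (π := π) hZ hsq hvar hφ).integral_prod_left.mono'
    (hm.pow 2).aestronglyMeasurable (Filter.Eventually.of_forall fun ω => ?_)
  have hcω := (hc ω).comp hφ
  rw [Real.norm_of_nonneg (sq_nonneg _)]
  exact sq_integral_le ((memLp_two_iff_integrable_sq hcω.measurable.aestronglyMeasurable).2
    (integrable_of_continuous (hcω.pow 2)))

/-- Exchange of expectation and averaging over the parameter. -/
lemma integral_integral_mul (hZ : Measurable fun p : Ω × X => Z p.1 p.2)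
    (hsq : ∀ x, Integrable (fun ω => Z ω x * Z ω x) P)
    (hvar : Continuous fun x => ∫ ω, Z ω x * Z ω x ∂P) (hφ : Continuous φ)
    {Y : Ω → ℝ} (hY : MemLp Y 2 P) :
    ∫ z, ∫ ω, Z ω (φ z) * Y ω ∂P ∂π = ∫ ω, (∫ z, Z ω (φ z) ∂π) * Y ω ∂P := by
  have hint : Integrable (fun p : Ω × X => Z p.1 (φ p.2) * Y p.1) (P.prod π) :=
    (memLp_two_prod hZ hsq hvar hφ).integrable_mul (hY.comp_fst π)
  rw [← integral_integral_swap hint]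
  simp only [integral_mul_const]

end SecondOrder

section Projection

variable {d : ℕ} {D : Fin d → Set ℝ} {ν : ∀ i, Measure (D i)}

lemma continuous_combine (u : Finset (Fin d)) :
    Continuous fun p : (∀ i, D i) × (∀ i, D i) => combine D u p.1 p.2 := by
  refine continuous_pi fun j => ?_
  by_cases hj : j ∈ u
  · simpa only [combine, hj, if_true, Function.comp_def] using
      (continuous_apply j).comp continuous_fst
  · simpa only [combine, hj, if_false, Function.comp_def] using
      (continuous_apply j).comp continuous_snd

lemma continuous_combine_right (u : Finset (Fin d)) (x : ∀ i, D i) :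
    Continuous (combine D u x) :=
  (continuous_combine u).comp (Continuous.prodMk_right x)

variable [∀ i, CompactSpace (D i)] [∀ i, IsProbabilityMeasure (ν i)]

lemma continuous_integral_param {W : Type*} [TopologicalSpace W] [FirstCountableTopology W]
    [LocallyCompactSpace W] {F : W → (∀ i, D i) → ℝ} (hF : Continuous (Function.uncurry F)) :
    Continuous fun w => ∫ z, F w z ∂(Measure.pi ν) := by
  simpa using continuous_parametric_integral_of_continuous (μ := Measure.pi ν) hF isCompact_univ

lemma continuous_Tproj (u : Finset (Fin d)) {f : (∀ i, D i) → ℝ} (hf : Continuous f) :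
    Continuous (Tproj D ν u f) :=
  continuous_finsetSum _ fun u' _ => continuous_const.mul
    (continuous_integral_param (hf.comp (continuous_combine u')))

lemma neg_one_pow_sub_sub {m n s t : ℕ} (hs : s ≤ m) (ht : t ≤ n) :
    (-1 : ℝ) ^ (m + n - s - t) = (-1) ^ (m - s) * (-1) ^ (n - t) := by
  rw [← pow_add]
  congr 1
  omega

/-- The KANOVA term of a continuous kernel applies the FANOVA projection in each argument. -/
lemma kanova_eq_Tproj (u v : Finset (Fin d)) {k : (∀ i, D i) → (∀ i, D i) → ℝ}
    (hk : Continuous fun p : (∀ i, D i) × (∀ i, D i) => k p.1 p.2) (x y : ∀ i, D i) :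
    kanova D ν u v k x y = Tproj D ν u (fun x' => Tproj D ν v (k x') y) x := by
  unfold kanova Tproj
  refine Finset.sum_congr rfl fun u' hu' => ?_
  rw [integral_finsetSum]
  · rw [Finset.mul_sum]
    refine Finset.sum_congr rfl fun v' hv' => ?_
    rw [integral_const_mul, neg_one_pow_sub_sub (card_le_card (mem_powerset.1 hu'))
      (card_le_card (mem_powerset.1 hv')), mul_assoc]
  · intro v' _
    refine Integrable.const_mul (integrable_of_continuous (continuous_integral_param ?_)) _
    exact hk.comp (((continuous_combine_right u' x).comp continuous_fst).prodMk
      ((continuous_combine_right v' y).comp continuous_snd))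

variable {Ω : Type*} [MeasurableSpace Ω] {P : Measure Ω} [IsProbabilityMeasure P]
  {Z : Ω → (∀ i, D i) → ℝ}

lemma memLp_two_Tproj (hZ : Measurable fun p : Ω × (∀ i, D i) => Z p.1 p.2)
    (hc : ∀ ω, Continuous (Z ω)) (hsq : ∀ x, Integrable (fun ω => Z ω x * Z ω x) P)
    (hvar : Continuous fun x => ∫ ω, Z ω x * Z ω x ∂P) (u : Finset (Fin d)) (x : ∀ i, D i) :
    MemLp (fun ω => Tproj D ν u (Z ω) x) 2 P :=
  memLp_finsetSum _ fun u' _ =>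
    (memLp_two_integral hZ hc hsq hvar (continuous_combine_right u' x)).const_mul _

/-- The FANOVA projection commutes with expectation against a square-integrable variable. -/
lemma Tproj_integral_mul (hZ : Measurable fun p : Ω × (∀ i, D i) => Z p.1 p.2)
    (hc : ∀ ω, Continuous (Z ω)) (hsq : ∀ x, Integrable (fun ω => Z ω x * Z ω x) P)
    (hvar : Continuous fun x => ∫ ω, Z ω x * Z ω x ∂P) (u : Finset (Fin d)) (x : ∀ i, D i)
    {Y : Ω → ℝ} (hY : MemLp Y 2 P) :
    Tproj D ν u (fun x' => ∫ ω, Z ω x' * Y ω ∂P) x = ∫ ω, Tproj D ν u (Z ω) x * Y ω ∂P := by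
  simp only [Tproj, Finset.sum_mul, mul_assoc]
  rw [integral_finsetSum]
  · refine Finset.sum_congr rfl fun u' _ => ?_
    rw [integral_const_mul,
      integral_integral_mul hZ hsq hvar (continuous_combine_right u' x) hY]
  · intro u' _
    exact ((memLp_two_integral hZ hc hsq hvar
      (continuous_combine_right u' x)).integrable_mul hY).const_mul _

/-- The KANOVA term of a covariance kernel is the cross-covariance of the FANOVA effects. -/
lemma kanova_eq_integral (hZ : Measurable fun p : Ω × (∀ i, D i) => Z p.1 p.2)
    (hc : ∀ ω, Continuous (Z ω)) (hsq : ∀ x, Integrable (fun ω => Z ω x * Z ω x) P)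
    {k : (∀ i, D i) → (∀ i, D i) → ℝ} (hk : ∀ x y, k x y = ∫ ω, Z ω x * Z ω y ∂P)
    (hkc : Continuous fun p : (∀ i, D i) × (∀ i, D i) => k p.1 p.2)
    (u v : Finset (Fin d)) (x y : ∀ i, D i) :
    kanova D ν u v k x y = ∫ ω, Tproj D ν u (Z ω) x * Tproj D ν v (Z ω) y ∂P := by
  have hvar : Continuous fun x => ∫ ω, Z ω x * Z ω x ∂P := by
    simp only [← hk]
    exact hkc.comp (continuous_id.prodMk continuous_id)
  have hinner (x' : ∀ i, D i) :
      Tproj D ν v (k x') y = ∫ ω, Z ω x' * Tproj D ν v (Z ω) y ∂P := by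
    have hkx : k x' = fun y' => ∫ ω, Z ω y' * Z ω x' ∂P := by
      funext y'
      simp only [hk, mul_comm]
    rw [hkx, Tproj_integral_mul hZ hc hsq hvar v y (memLp_two_section hZ hsq x')]
    simp only [mul_comm]
  rw [kanova_eq_Tproj u v hkc]
  simp only [hinner]
  exact Tproj_integral_mul hZ hc hsq hvar u x (memLp_two_Tproj hZ hc hsq hvar v y)

/-- A sample path's FANOVA effect vanishes identically with probability one as soon as it
vanishes almost surely at each point. -/
lemma prob_Tproj_eq_zero_iff (hZ : Measurable fun p : Ω × (∀ i, D i) => Z p.1 p.2)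
    (hc : ∀ ω, Continuous (Z ω)) (u : Finset (Fin d)) :
    P {ω | ∀ x, Tproj D ν u (Z ω) x = 0} = 1 ↔ ∀ x, ∀ᵐ ω ∂P, Tproj D ν u (Z ω) x = 0 := by
  obtain ⟨s, hs, hsd⟩ := TopologicalSpace.exists_countable_dense (∀ i, D i)
  have hset : {ω | ∀ x, Tproj D ν u (Z ω) x = 0} = {ω | ∀ x ∈ s, Tproj D ν u (Z ω) x = 0} := by
    ext ω
    refine ⟨fun h x _ => h x, fun h => ?_⟩
    exact congrFun ((continuous_Tproj u (hc ω)).ext_on hsd continuous_const h)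
  have hmeas (x : ∀ i, D i) : Measurable fun ω => Tproj D ν u (Z ω) x :=
    Finset.measurable_fun_sum _ fun u' _ => measurable_const.mul
      (measurable_uncurry_comp hZ
        (continuous_combine_right u' x)).stronglyMeasurable.integral_prod_right'.measurable
  have hms : MeasurableSet {ω | ∀ x ∈ s, Tproj D ν u (Z ω) x = 0} := by
    simp only [Set.ofPred_forall]
    exact MeasurableSet.biInter hs fun x _ => hmeas x (measurableSet_singleton 0)
  constructor
  · intro h x
    rw [hset, ← mem_ae_iff_prob_eq_one hms, ← hset] at h
    filter_upwards [h] with ω hω using hω x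
  · intro h
    rw [hset, ← mem_ae_iff_prob_eq_one hms]
    exact (ae_ball_iff hs).2 fun x _ => h x

end Projection

end FanovaSparsity

/-- **Sparsity equivalences.**  For a jointly measurable, centred process `Z` with
continuous sample paths and continuous covariance kernel `k(x,y) = E[Z_x Z_y]`,
and any `u ⊆ I`, the following are equivalent:
(i) `T_u k(·,y) = 0` for all `y`;
(ii) `k_{u,u} = 0`;
(iii) `k_{u,u}(x,x) = 0` for all `x`;
(iv) the FANOVA effect `Z^{(u)}` vanishes identically with probability one. -/
theorem fanova_sparsity_equivalences {d : ℕ} (hd : 1 ≤ d)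
    (a b : Fin d → ℝ) (hab : ∀ i, a i < b i)
    (D : Fin d → Set ℝ) (hD : ∀ i, D i = Set.Icc (a i) (b i))
    (ν : ∀ i, Measure (D i)) [∀ i, IsProbabilityMeasure (ν i)]
    {Ω : Type*} [MeasurableSpace Ω] (P : Measure Ω) [IsProbabilityMeasure P]
    (Z : Ω → (∀ i, D i) → ℝ)
    (hZ_meas : Measurable (fun p : Ω × (∀ i, D i) => Z p.1 p.2))
    (hZ_cont : ∀ ω, Continuous (Z ω))
    (hZ_int : ∀ x, Integrable (fun ω => Z ω x) P)
    (hZ_centred : ∀ x, ∫ ω, Z ω x ∂P = 0)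
    (hZ_sq_int : ∀ x y, Integrable (fun ω => Z ω x * Z ω y) P)
    (k : (∀ i, D i) → (∀ i, D i) → ℝ)
    (hk : ∀ x y, k x y = ∫ ω, Z ω x * Z ω y ∂P)
    (hk_cont : Continuous (fun p : (∀ i, D i) × (∀ i, D i) => k p.1 p.2))
    (u : Finset (Fin d)) :
    List.TFAE
      [ ∀ x y : ∀ i, D i, Tproj D ν u (fun x' => k x' y) x = 0,
        ∀ x y : ∀ i, D i, kanova D ν u u k x y = 0,
        ∀ x : ∀ i, D i, kanova D ν u u k x x = 0,
        P {ω | ∀ x : ∀ i, D i, Tproj D ν u (Z ω) x = 0} = 1 ] := by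
  have hcompact (i : Fin d) : CompactSpace (D i) := by
    rw [hD i]
    infer_instance
  have hsq (x : ∀ i, D i) := hZ_sq_int x x
  have hvar : Continuous fun x => ∫ ω, Z ω x * Z ω x ∂P := by
    simp only [← hk]
    exact hk_cont.comp (continuous_id.prodMk continuous_id)
  have hcov (x y : ∀ i, D i) :=
    FanovaSparsity.kanova_eq_integral (ν := ν) hZ_meas hZ_cont hsq hk hk_cont u u x y
  rw [FanovaSparsity.prob_Tproj_eq_zero_iff hZ_meas hZ_cont u]
  tfae_have 1 → 2 := by
    intro h x y
    have hsymm (x' : ∀ i, D i) : k x' = fun y' => k y' x' := by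
      funext y'
      simp only [hk, mul_comm]
    have hinner (x' : ∀ i, D i) : Tproj D ν u (k x') y = 0 := by
      rw [hsymm x']
      exact h y x'
    rw [FanovaSparsity.kanova_eq_Tproj u u hk_cont]
    simp only [hinner]
    simp [Tproj]
  tfae_have 2 → 3 := fun h x => h x x
  tfae_have 3 → 4 := by
    intro h x
    have hint := (FanovaSparsity.memLp_two_Tproj (ν := ν) hZ_meas hZ_cont hsq hvar u x)
    have h0 := (integral_eq_zero_iff_of_nonneg (fun ω => mul_self_nonneg _)
      (hint.integrable_mul hint)).1 ((hcov x x).symm.trans (h x))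
    filter_upwards [h0] with ω hω using mul_self_eq_zero.1 hω
  tfae_have 4 → 1 := by
    intro h x y
    simp only [hk]
    rw [FanovaSparsity.Tproj_integral_mul hZ_meas hZ_cont hsq hvar u x
      (FanovaSparsity.memLp_two_section hZ_meas hsq y)]
    refine integral_eq_zero_of_ae ?_
    filter_upwards [h x] with ω hω
    simp [hω]
  tfae_finish
end

section
/- Fix p ∈ ℕ and ζ > 0, and define the Matérn kernel of smoothness ν = p + 1/2 by k(x,y) = (p!/(2p)!) Σ_{i=0}^p ((p+i)!/(i! (p−i)!)) (2|x−y|/ζ)^{p−i} exp(−|x−y|/ζ). Define c_{p,ℓ} = (1/ℓ!) Σ_{i=0}^{p−ℓ} ((p+i)!/i!) 2^{p−i} for 0 ≤ ℓ ≤ p, and A_p(t) = (Σ_{ℓ=0}^p c_{p,ℓ} t^ℓ) exp(−t). Then for every y ∈ [0,1], ∫₀¹ k(x,y) dx = ζ (p!/(2p)!) (2 c_{p,0} − A_p(y/ζ) − A_p((1−y)/ζ)). -/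
open Real Finset

/-- The derivative of the `n`-th exponential Taylor polynomial times `exp (-t)` telescopes. -/
theorem hasDerivAt_sum_pow_div_factorial_mul_exp_neg (n : ℕ) (t : ℝ) :
    HasDerivAt (fun t : ℝ => (∑ l ∈ Finset.range (n + 1), t ^ l / (l.factorial : ℝ)) * Real.exp (-t))
      (-(t ^ n / (n.factorial : ℝ) * Real.exp (-t))) t := by
  have hexp : HasDerivAt (fun t : ℝ => Real.exp (-t)) (-Real.exp (-t)) t := by
    simpa using (hasDerivAt_neg t).exp
  induction n with
  | zero => simpa using hexp
  | succ n ih =>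
    have hpow := ((hasDerivAt_pow (n + 1) t).div_const ((n + 1).factorial : ℝ)).mul hexp
    have hfun : (fun t : ℝ =>
          (∑ l ∈ Finset.range (n + 1 + 1), t ^ l / (l.factorial : ℝ)) * Real.exp (-t)) =
        (fun t : ℝ => (∑ l ∈ Finset.range (n + 1), t ^ l / (l.factorial : ℝ)) * Real.exp (-t)) +
          (fun t : ℝ => t ^ (n + 1) / ((n + 1).factorial : ℝ)) * fun t : ℝ => Real.exp (-t) := by
      ext t
      simp only [Finset.sum_range_succ _ (n + 1), Pi.add_apply, Pi.mul_apply, add_mul]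
    rw [hfun]
    refine (ih.add hpow).congr_deriv ?_
    have hn : (n.factorial : ℝ) ≠ 0 := by positivity
    rw [Nat.factorial_succ]
    push_cast
    field_simp
    ring

/-- Interchanging the two sums over the triangle `i + l ≤ p`. -/
theorem sum_range_div_factorial_mul_pow_eq (p : ℕ) (b : ℕ → ℝ) (t : ℝ) :
    ∑ l ∈ Finset.range (p + 1),
        (1 / (l.factorial : ℝ) * ∑ i ∈ Finset.range (p - l + 1), b i) * t ^ l =
      ∑ i ∈ Finset.range (p + 1),
        b i * ∑ l ∈ Finset.range (p - i + 1), t ^ l / (l.factorial : ℝ) := by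
  simp only [Finset.mul_sum, Finset.sum_mul]
  rw [Finset.sum_comm' (s' := fun i => Finset.range (p - i + 1)) (t' := Finset.range (p + 1))]
  · refine Finset.sum_congr rfl fun i _ => Finset.sum_congr rfl fun l _ => ?_
    ring
  · intro l i
    simp only [Finset.mem_range]
    omega

/-- If `A' = -G` with `G` continuous, the integral of `G (|x - y| / ζ)` over `[a, b] ∋ y` is
expressed through the values of `A`. -/
theorem integral_comp_abs_sub_div {A G : ℝ → ℝ} (hG : Continuous G)
    (hA : ∀ t, HasDerivAt A (-G t) t) {ζ : ℝ} (hζ : ζ ≠ 0) {a b y : ℝ} (hay : a ≤ y)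
    (hyb : y ≤ b) :
    ∫ x in a..b, G (|x - y| / ζ) = ζ * (2 * A 0 - A ((y - a) / ζ) - A ((b - y) / ζ)) := by
  have hcont : Continuous fun x => G (|x - y| / ζ) := by fun_prop
  have hleft : ∫ x in a..y, G (|x - y| / ζ) = ζ * A 0 - ζ * A ((y - a) / ζ) := by
    have hcongr : ∫ x in a..y, G (|x - y| / ζ) = ∫ x in a..y, G ((y - x) / ζ) := by
      refine intervalIntegral.integral_congr fun x hx => ?_
      rw [Set.uIcc_of_le hay] at hx
      simp only [abs_of_nonpos (sub_nonpos.2 hx.2), neg_sub]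
    rw [hcongr, intervalIntegral.integral_eq_sub_of_hasDerivAt
      (f := fun x => ζ * A ((y - x) / ζ))]
    · simp
    · intro x _
      refine (((hA ((y - x) / ζ)).comp x
        (((hasDerivAt_id x).const_sub y).div_const ζ)).const_mul ζ).congr_deriv ?_
      field_simp
    · exact Continuous.intervalIntegrable (by fun_prop) _ _
  have hright : ∫ x in y..b, G (|x - y| / ζ) = ζ * A 0 - ζ * A ((b - y) / ζ) := by
    have hcongr : ∫ x in y..b, G (|x - y| / ζ) = ∫ x in y..b, G ((x - y) / ζ) := by
      refine intervalIntegral.integral_congr fun x hx => ?_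
      rw [Set.uIcc_of_le hyb] at hx
      simp only [abs_of_nonneg (sub_nonneg.2 hx.1)]
    rw [hcongr, intervalIntegral.integral_eq_sub_of_hasDerivAt
      (f := fun x => -(ζ * A ((x - y) / ζ)))]
    · simp only [sub_self, zero_div]
      ring
    · intro x _
      refine (((hA ((x - y) / ζ)).comp x
        (((hasDerivAt_id x).sub_const y).div_const ζ)).const_mul ζ).neg.congr_deriv ?_
      field_simp
    · exact Continuous.intervalIntegrable (by fun_prop) _ _
  rw [← intervalIntegral.integral_add_adjacent_intervals (hcont.intervalIntegrable a y)
    (hcont.intervalIntegrable y b), hleft, hright]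
  ring

/-- **Integral of the Matérn kernel of smoothness `ν = p + 1/2`.**  With
`k(x,y) = (p!/(2p)!) ∑_{i=0}^p ((p+i)!/(i!(p−i)!)) (2|x−y|/ζ)^{p−i} exp(−|x−y|/ζ)`,
`c_{p,ℓ} = (1/ℓ!) ∑_{i=0}^{p−ℓ} ((p+i)!/i!) 2^{p−i}` and
`A_p(t) = (∑_{ℓ=0}^p c_{p,ℓ} t^ℓ) exp(−t)`, one has for every `y ∈ [0,1]`
`∫₀¹ k(x,y) dx = ζ (p!/(2p)!) (2 c_{p,0} − A_p(y/ζ) − A_p((1−y)/ζ))`. -/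
theorem integral_matern_kernel (p : ℕ) (ζ : ℝ) (hζ : 0 < ζ)
    (k : ℝ → ℝ → ℝ)
    (hk : ∀ x y : ℝ, k x y =
      ((p.factorial : ℝ) / ((2 * p).factorial : ℝ)) *
        ∑ i ∈ Finset.range (p + 1),
          (((p + i).factorial : ℝ) / ((i.factorial : ℝ) * ((p - i).factorial : ℝ))) *
            (2 * |x - y| / ζ) ^ (p - i) * Real.exp (-|x - y| / ζ))
    (c : ℕ → ℝ)
    (hc : ∀ ℓ, c ℓ = (1 / (ℓ.factorial : ℝ)) *
      ∑ i ∈ Finset.range (p - ℓ + 1),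
        (((p + i).factorial : ℝ) / (i.factorial : ℝ)) * 2 ^ (p - i))
    (A : ℝ → ℝ)
    (hA : ∀ t, A t = (∑ ℓ ∈ Finset.range (p + 1), c ℓ * t ^ ℓ) * Real.exp (-t))
    (y : ℝ) (hy : y ∈ Set.Icc (0:ℝ) 1) :
    ∫ x in (0:ℝ)..1, k x y =
      ζ * ((p.factorial : ℝ) / ((2 * p).factorial : ℝ)) *
        (2 * c 0 - A (y / ζ) - A ((1 - y) / ζ)) := by
  set b : ℕ → ℝ := fun i => ((p + i).factorial : ℝ) / (i.factorial : ℝ) * 2 ^ (p - i) with hb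
  set G : ℝ → ℝ := fun t => ∑ i ∈ Finset.range (p + 1),
    b i * (t ^ (p - i) / ((p - i).factorial : ℝ) * Real.exp (-t)) with hG
  have hA' : A = fun t => ∑ i ∈ Finset.range (p + 1), b i *
      ((∑ l ∈ Finset.range (p - i + 1), t ^ l / (l.factorial : ℝ)) * Real.exp (-t)) := by
    ext t
    simp only [hA, hc, ← mul_assoc, ← Finset.sum_mul]
    rw [sum_range_div_factorial_mul_pow_eq p b t]
  have hderiv : ∀ t, HasDerivAt A (-G t) t := by
    intro t
    rw [hA']
    refine (HasDerivAt.fun_sum fun i _ =>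
      (hasDerivAt_sum_pow_div_factorial_mul_exp_neg (p - i) t).const_mul (b i)).congr_deriv ?_
    simp only [hG, mul_neg, Finset.sum_neg_distrib]
  have hA0 : A 0 = c 0 := by
    rw [hA, Finset.sum_range_succ']
    simp
  have hkG : ∀ x, k x y =
      ((p.factorial : ℝ) / ((2 * p).factorial : ℝ)) * G (|x - y| / ζ) := by
    intro x
    rw [hk]
    congr 1
    refine Finset.sum_congr rfl fun i _ => ?_
    simp only [hb]
    rw [mul_div_assoc, mul_pow, neg_div]
    field_simp
  simp only [hkG]
  rw [intervalIntegral.integral_const_mul, integral_comp_abs_sub_div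
    (by fun_prop) hderiv hζ.ne' hy.1 hy.2, hA0, sub_zero]
  ring
end

section
/- For every ζ > 0, ∫₀¹∫₀¹ (1 + |x−y|/ζ + (x−y)²/(3ζ²)) exp(−|x−y|/ζ) dx dy = (1/3) ζ (16 − 30ζ) + (2/3) (1 + 7ζ + 15ζ²) exp(−1/ζ). -/
open Real

/-- Integrating a continuous function of `|x - y|` over `x ∈ [0, 1]` by means of a primitive. -/
lemma integral_comp_abs_sub_of_hasDerivAt {g G : ℝ → ℝ} (hg : Continuous g)
    (hG : ∀ t, HasDerivAt G (g t) t) {y : ℝ} (hy0 : 0 ≤ y) (hy1 : y ≤ 1) :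
    ∫ x in (0:ℝ)..1, g |x - y| = G y + G (1 - y) - 2 * G 0 := by
  have hcont : Continuous fun x => g |x - y| := by fun_prop
  have hprim (a b : ℝ) : ∫ t in a..b, g t = G b - G a :=
    intervalIntegral.integral_eq_sub_of_hasDerivAt (fun t _ => hG t) (hg.intervalIntegrable a b)
  have hleft : ∫ x in (0:ℝ)..y, g |x - y| = G y - G 0 := by
    have : ∫ x in (0:ℝ)..y, g |x - y| = ∫ x in (0:ℝ)..y, g (y - x) := by
      refine intervalIntegral.integral_congr fun x hx => ?_
      rw [Set.uIcc_of_le hy0] at hx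
      simp only [abs_sub_comm x y, abs_of_nonneg (sub_nonneg.2 hx.2)]
    rw [this, intervalIntegral.integral_comp_sub_left, hprim, sub_self, sub_zero]
  have hright : ∫ x in y..1, g |x - y| = G (1 - y) - G 0 := by
    have : ∫ x in y..1, g |x - y| = ∫ x in y..1, g (x - y) := by
      refine intervalIntegral.integral_congr fun x hx => ?_
      rw [Set.uIcc_of_le hy1] at hx
      simp only [abs_of_nonneg (sub_nonneg.2 hx.1)]
    rw [this, intervalIntegral.integral_comp_sub_right, hprim, sub_self]
  rw [← intervalIntegral.integral_add_adjacent_intervals (hcont.intervalIntegrable 0 y)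
    (hcont.intervalIntegrable y 1), hleft, hright]
  ring

/-- The double integral over the unit square of a continuous function of `|x - y|`, in terms of
its first and second primitives. -/
lemma integral_integral_comp_abs_sub_of_hasDerivAt {g G H : ℝ → ℝ} (hg : Continuous g)
    (hG : ∀ t, HasDerivAt G (g t) t) (hH : ∀ t, HasDerivAt H (G t) t) :
    ∫ y in (0:ℝ)..1, ∫ x in (0:ℝ)..1, g |x - y| = 2 * (H 1 - H 0 - G 0) := by
  have hGc : Continuous G := continuous_iff_continuousAt.2 fun t => (hG t).continuousAt
  have hinner : ∫ y in (0:ℝ)..1, ∫ x in (0:ℝ)..1, g |x - y| =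
      ∫ y in (0:ℝ)..1, (G y + G (1 - y) - 2 * G 0) := by
    refine intervalIntegral.integral_congr fun y hy => ?_
    rw [Set.uIcc_of_le zero_le_one] at hy
    exact integral_comp_abs_sub_of_hasDerivAt hg hG hy.1 hy.2
  have hderiv (y : ℝ) : HasDerivAt (fun y => H y - H (1 - y) - 2 * G 0 * y)
      (G y + G (1 - y) - 2 * G 0) y := by
    have h := (hH (1 - y)).comp y ((hasDerivAt_id y).const_sub 1)
    exact (((hH y).sub h).sub ((hasDerivAt_id y).const_mul (2 * G 0))).congr_deriv (by ring)
  rw [hinner, intervalIntegral.integral_eq_sub_of_hasDerivAt (fun y _ => hderiv y)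
    (Continuous.intervalIntegrable (by fun_prop) 0 1)]
  simp only [sub_self, sub_zero]
  ring

/-- The derivative of a quadratic polynomial times `exp (-t / ζ)`. -/
lemma hasDerivAt_quadratic_mul_exp_neg_div (a b c ζ t : ℝ) :
    HasDerivAt (fun t => (a + b * t + c * t ^ 2) * Real.exp (-t / ζ))
      ((b + 2 * c * t - (a + b * t + c * t ^ 2) / ζ) * Real.exp (-t / ζ)) t := by
  have hexp := ((hasDerivAt_id t).neg.div_const ζ).exp
  have hpoly := (((hasDerivAt_id t).const_mul b).const_add a).add
    (((hasDerivAt_id t).pow 2).const_mul c)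
  refine (hpoly.mul hexp).congr_deriv ?_
  simp
  ring

/-- **Double integral of the Matérn 5/2 kernel.**  For every `ζ > 0`,
`∫₀¹∫₀¹ (1 + |x−y|/ζ + (x−y)²/(3ζ²)) exp(−|x−y|/ζ) dx dy
   = (1/3) ζ (16 − 30ζ) + (2/3) (1 + 7ζ + 15ζ²) exp(−1/ζ)`. -/
theorem double_integral_matern52_kernel (ζ : ℝ) (hζ : 0 < ζ) :
    ∫ y in (0:ℝ)..1, ∫ x in (0:ℝ)..1,
        (1 + |x - y| / ζ + (x - y) ^ 2 / (3 * ζ ^ 2)) * Real.exp (-|x - y| / ζ) =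
      (1 / 3) * ζ * (16 - 30 * ζ) + (2 / 3) * (1 + 7 * ζ + 15 * ζ ^ 2) * Real.exp (-1 / ζ) := by
  have hζ0 : ζ ≠ 0 := hζ.ne'
  have h := integral_integral_comp_abs_sub_of_hasDerivAt
    (g := fun t => (1 + t / ζ + t ^ 2 / (3 * ζ ^ 2)) * Real.exp (-t / ζ))
    (G := fun t => (-(8 * ζ / 3) + -(5 / 3) * t + -(1 / (3 * ζ)) * t ^ 2) * Real.exp (-t / ζ))
    (H := fun t => (5 * ζ ^ 2 + 7 * ζ / 3 * t + 1 / 3 * t ^ 2) * Real.exp (-t / ζ))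
    (by fun_prop)
    (fun t => by
      convert hasDerivAt_quadratic_mul_exp_neg_div _ _ _ ζ t using 2
      field_simp
      ring)
    (fun t => by
      convert hasDerivAt_quadratic_mul_exp_neg_div _ _ _ ζ t using 2
      field_simp
      ring)
  simp only [sq_abs] at h
  rw [h]
  simp only [neg_zero, zero_div, Real.exp_zero]
  ring
end
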